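/- If G ≤ S∞ is a maximal cofinitary group which is freely generated by some subset of its elements (i.e., G is a free group), then G, viewed as a set of functions ℕ → ℕ, is not a Gδ subset of Baire space. -/

import Mathlib

/-- A subgroup of `S∞ = Equiv.Perm ℕ` is cofinitary if every non-identity element has only
finitely many fixed points. -/
def IsCofinitary (G : Subgroup (Equiv.Perm ℕ)) : Prop :=
  ∀ g ∈ G, g ≠ 1 → {n : ℕ | g n = n}.Finite

/-- A cofinitary group is maximal if it is not strictly contained in any cofinitary group. -/
def IsMaximalCofinitary (G : Subgroup (Equiv.Perm ℕ)) : Prop :=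
  IsCofinitary G ∧ ∀ H : Subgroup (Equiv.Perm ℕ), IsCofinitary H → G ≤ H → G = H

/-- A set `F` of permutations freely generates the subgroup it generates:
`⟨F⟩` is a free group with basis `F`. -/
def FreelyGenerates (F : Set (Equiv.Perm ℕ)) : Prop :=
  ∃ φ : FreeGroup F ≃* (Subgroup.closure F),
    ∀ x : F, (φ (FreeGroup.of x) : Equiv.Perm ℕ) = (x : Equiv.Perm ℕ)

theorem aux_seq {α : Type*} (Q : List α → α → Prop) (h : ∀ l, ∃ y, Q l y) :
    ∃ f : ℕ → α, ∀ n, Q ((List.range n).map f) (f n) := by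
  choose s hs using h
  let L : ℕ → List α := fun n => Nat.rec [] (fun _ l => l ++ [s l]) n
  have hL : ∀ n, L n = (List.range n).map (fun n => s (L n)) := by
    intro n
    induction n with
    | zero => rfl
    | succ n ih =>
      rw [List.range_succ, List.map_append, ← ih]
      rfl
  refine ⟨fun n => s (L n), fun n => ?_⟩
  rw [← hL]
  exact hs _

theorem aux_norm_pow {α : Type*} [DecidableEq α] (x : FreeGroup α) (hx : x ≠ 1) (k : ℕ) :
    x.norm + k ≤ (x ^ (k + 1)).norm := by
  have h1 := FreeGroup.reduceCyclically.conj_conjugator_reduceCyclically x.toWord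
  have h2 := FreeGroup.reduceCyclically.reduce_flatten_replicate_succ
    (FreeGroup.isReduced_toWord (x := x)) k
  rw [← FreeGroup.toWord_pow] at h2
  have h3 : FreeGroup.reduceCyclically x.toWord ≠ [] := by
    intro h
    apply hx
    rw [← FreeGroup.mk_toWord (x := x), ← h1, h, List.append_nil, ← FreeGroup.mul_mk,
      ← FreeGroup.inv_mk, mul_inv_cancel]
  have h4 := List.length_pos_iff.2 h3
  have e1 := congrArg List.length h1
  have e2 := congrArg List.length h2
  simp only [List.length_append, FreeGroup.invRev_length, List.length_flatten, List.map_replicate,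
    List.sum_replicate, smul_eq_mul] at e1 e2
  unfold FreeGroup.norm
  nlinarith

theorem aux_cont_iterate (k : ℕ) (i : ℕ) : Continuous (fun f : ℕ → ℕ => f^[k] i) := by
  induction k with
  | zero => exact continuous_const
  | succ k ih =>
    simp only [Function.iterate_succ_apply']
    rw [continuous_iff_continuousAt]
    intro f0
    have h1 : ∀ᶠ f in nhds f0, f^[k] i = f0^[k] i :=
      (ih.continuousAt (x := f0)).eventually
        (p := fun n => n = f0^[k] i) (by simp [nhds_discrete])
    have h2 : ContinuousAt (fun f : ℕ → ℕ => f (f0^[k] i)) f0 := (continuous_apply _).continuousAt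
    exact h2.congr (h1.mono fun f hf => by simp [hf])

theorem aux_cyl (f : ℕ → ℕ) (U : Set (ℕ → ℕ)) (hU : IsOpen U) (hf : f ∈ U) :
    ∃ L, ∀ v : ℕ → ℕ, (∀ i < L, v i = f i) → v ∈ U := by
  obtain ⟨s, ⟨x, n, rfl⟩, h1, h2⟩ :=
    (PiNat.isTopologicalBasis_cylinders (fun _ : ℕ => ℕ)).exists_subset_of_mem_open hf hU
  refine ⟨n, fun v hv => h2 ?_⟩
  rw [PiNat.mem_cylinder_iff_eq.1 h1 |>.symm]
  exact hv

theorem aux_dudley (G : Subgroup (Equiv.Perm ℕ)) (ν : G → ℕ) (hν1 : ν 1 = 0)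
    (hνm : ∀ a b, ν (a * b) ≤ ν a + ν b) (hνi : ∀ a, ν a⁻¹ = ν a)
    (hνp : ∀ a, a ≠ 1 → ∀ k, ν a + k ≤ ν (a ^ (k + 1)))
    (hnd : ∀ N : ℕ, ∃ g : G, g ≠ 1 ∧ ∀ i < N, (g : Equiv.Perm ℕ) i = i)
    (hG : IsGδ ((fun g : Equiv.Perm ℕ => (g : ℕ → ℕ)) '' (G : Set (Equiv.Perm ℕ)))) : False := by
  obtain ⟨U, hUo, hU⟩ := hG.eq_iInter_nat
  let α := {g : G // g ≠ 1}
  let Φ : α → (ℕ → ℕ) → (ℕ → ℕ) := fun y f => fun i => (y.1 : Equiv.Perm ℕ) (f^[ν y.1 + 2] i)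
  let P : List α → (ℕ → ℕ) → (ℕ → ℕ) := fun l f => l.foldr Φ f
  have hPc : ∀ l, Continuous (P l) := by
    intro l
    induction l with
    | nil => exact continuous_id
    | cons y l ih =>
      refine continuous_pi fun i => ?_
      exact (continuous_of_discreteTopology (f := fun n : ℕ => (y.1 : Equiv.Perm ℕ) n)).comp
        ((aux_cont_iterate (ν y.1 + 2) i).comp ih)
  have hPG : ∀ l, ∃ x : G, P l id = ((x : Equiv.Perm ℕ) : ℕ → ℕ) := by
    intro l
    induction l with
    | nil => exact ⟨1, rfl⟩
    | cons y l ih =>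
      obtain ⟨x, hx⟩ := ih
      refine ⟨y.1 * x ^ (ν y.1 + 2), ?_⟩
      funext i
      change (y.1 : Equiv.Perm ℕ) ((P l id)^[ν y.1 + 2] i) = _
      rw [hx, Equiv.Perm.iterate_eq_pow]
      rfl
  have hPU : ∀ l i, P l id ∈ U i := by
    intro l i
    obtain ⟨x, hx⟩ := hPG l
    have : P l id ∈ ((fun g : Equiv.Perm ℕ => (g : ℕ → ℕ)) '' (G : Set (Equiv.Perm ℕ))) :=
      ⟨x, x.2, hx.symm⟩
    rw [hU] at this
    exact Set.mem_iInter.1 this i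
  have hL : ∀ l : List α, ∃ L : ℕ, l.length ≤ L ∧ ∀ n ≤ l.length, ∀ j ≤ l.length,
      ∀ v : ℕ → ℕ, (∀ i < L, v i = P (l.drop n) id i) → v ∈ U j := by
    intro l
    choose L0 hL0 using fun n j => aux_cyl (P (l.drop n) id) (U j) (hUo j) (hPU _ j)
    refine ⟨l.length + ∑ n ∈ Finset.range (l.length + 1), ∑ j ∈ Finset.range (l.length + 1), L0 n j,
      by omega, fun n hn j hj v hv => hL0 n j v fun i hi => hv i ?_⟩
    have a1 := Finset.single_le_sum (f := fun j => L0 n j) (s := Finset.range (l.length + 1))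
      (fun _ _ => Nat.zero_le _) (Finset.mem_range.2 (Nat.lt_succ_of_le hj))
    have a2 := Finset.single_le_sum (f := fun n => ∑ j ∈ Finset.range (l.length + 1), L0 n j)
      (s := Finset.range (l.length + 1))
      (fun _ _ => Nat.zero_le _) (Finset.mem_range.2 (Nat.lt_succ_of_le hn))
    beta_reduce at a1 a2
    omega
  choose L hLl hL using hL
  have hN : ∀ l : List α, ∃ N : ℕ, ∀ f : ℕ → ℕ, (∀ i < N, f i = i) → ∀ n ≤ l.length, ∀ i < L l,
      P (l.drop n) f i = P (l.drop n) id i := by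
    intro l
    obtain ⟨N, hN⟩ := aux_cyl id
      (⋂ n ∈ Finset.range (l.length + 1), (P (l.drop n)) ⁻¹' PiNat.cylinder (P (l.drop n) id) (L l))
      (isOpen_biInter_finset fun n _ => (PiNat.isOpen_cylinder _ _ _).preimage (hPc _))
      (by simp)
    refine ⟨N, fun f hf n hn i hi => ?_⟩
    have := hN f hf
    simp only [Set.mem_iInter, Finset.mem_range] at this
    exact this n (by omega) i hi
  choose N hN using hN
  obtain ⟨g, hg⟩ := aux_seq (fun (l : List α) (y : α) =>
      ∀ j ≤ l.length, ∀ i < N (l.take j), (y.1 : Equiv.Perm ℕ) i = i) (by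
    intro l
    obtain ⟨y, hy, hy2⟩ := hnd (∑ j ∈ Finset.range (l.length + 1), N (l.take j))
    refine ⟨⟨y, hy⟩, fun j hj i hi => hy2 i ?_⟩
    exact lt_of_lt_of_le hi (Finset.single_le_sum (f := fun j => N (l.take j))
      (fun _ _ => Nat.zero_le _) (Finset.mem_range.2 (Nat.lt_succ_of_le hj))))
  let l : ℕ → List α := fun m => (List.range m).map g
  have hll : ∀ m, (l m).length = m := by simp [l]
  have htake : ∀ m m', m ≤ m' → (l m').take m = l m := by
    intro m m' h
    simp [l, ← List.map_take, List.take_range, h]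
  have hg' : ∀ m m', m ≤ m' → ∀ i < N (l m), ((g m').1 : Equiv.Perm ℕ) i = i := by
    intro m m' h i hi
    have := hg m' m (by simpa using h) i
    rw [show List.take m (List.map g (List.range m')) = l m from htake m m' h] at this
    exact this hi
  let w : ℕ → ℕ → ℕ → ℕ := fun n m => P ((l m).drop n) id
  have hfix : ∀ (l' : List α) (M : ℕ), (∀ y ∈ l', ∀ i < M, (y.1 : Equiv.Perm ℕ) i = i) →
      ∀ i < M, P l' id i = i := by
    intro l' M
    induction l' with
    | nil => intro _ i _; rfl
    | cons y l' ih =>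
      intro h i hi
      have ih' := ih (fun y hy => h y (List.mem_cons_of_mem _ hy)) i hi
      change (y.1 : Equiv.Perm ℕ) ((P l' id)^[ν y.1 + 2] i) = i
      rw [Function.iterate_fixed ih', h y List.mem_cons_self i hi]
  have hwfix : ∀ m m', m ≤ m' → ∀ i < N (l m), w m m' i = i := by
    intro m m' h
    refine hfix _ _ fun y hy => ?_
    obtain ⟨j, hj, rfl⟩ := List.mem_iff_getElem.1 hy
    simp only [l, List.getElem_drop, List.getElem_map, List.getElem_range]
    exact hg' m (m + j) (by omega)
  have hww : ∀ n m m', n ≤ m → m ≤ m' → w n m' = P ((l m).drop n) (w m m') := by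
    intro n m m' h h'
    have e : l m' = l m ++ (l m').drop m := by
      conv_lhs => rw [← List.take_append_drop m (l m'), htake m m' h']
    change P ((l m').drop n) id = P _ (P ((l m').drop m) id)
    conv_lhs => rw [e, List.drop_append_of_le_length (by rw [hll]; exact h)]
    exact List.foldr_append
  have hagree : ∀ n m m', n ≤ m → m ≤ m' → ∀ i < L (l m), w n m' i = w n m i := by
    intro n m m' h h' i hi
    rw [hww n m m' h h']
    exact hN (l m) _ (hwfix m m' h') n (by rw [hll]; exact h) i hi
  have hLm : ∀ m, m ≤ L (l m) := fun m => by have := hLl (l m); rwa [hll] at this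
  let yf : ℕ → ℕ → ℕ := fun n i => w n (n + i + 1) i
  have hyf : ∀ n i m, n + i + 1 ≤ m → w n m i = yf n i := by
    intro n i m h
    exact hagree n (n + i + 1) m (by omega) h i (lt_of_lt_of_le (by omega) (hLm _))
  have hyU : ∀ n j, yf n ∈ U j := by
    intro n j
    refine hL (l (n + j)) n (by rw [hll]; omega) j (by rw [hll]; omega) _ fun i hi => ?_
    rw [← hyf n i (n + i + 1 + j) (by omega)]
    exact hagree n (n + j) _ (by omega) (by omega) i hi
  have hyG : ∀ n, ∃ x : G, ((x : Equiv.Perm ℕ) : ℕ → ℕ) = yf n := by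
    intro n
    have : yf n ∈ ((fun g : Equiv.Perm ℕ => (g : ℕ → ℕ)) '' (G : Set (Equiv.Perm ℕ))) := by
      rw [hU]; exact Set.mem_iInter.2 (hyU n)
    obtain ⟨x, hx, hx'⟩ := this
    exact ⟨⟨x, hx⟩, hx'⟩
  choose y hy using hyG
  have hiter : ∀ n i k, ∃ M, ∀ m ≥ M, (w n m)^[k] i = (yf n)^[k] i := by
    intro n i k
    induction k with
    | zero => exact ⟨0, fun _ _ => rfl⟩
    | succ k ih =>
      obtain ⟨M, hM⟩ := ih
      refine ⟨M + (n + (yf n)^[k] i + 1), fun m hm => ?_⟩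
      rw [Function.iterate_succ_apply', Function.iterate_succ_apply', hM m (by omega)]
      exact hyf _ _ _ (by omega)
  have hrec : ∀ n, y n = (g n).1 * y (n + 1) ^ (ν (g n).1 + 2) := by
    intro n
    apply Subtype.ext
    apply Equiv.ext
    intro i
    rw [Subgroup.coe_mul, Subgroup.coe_pow, Equiv.Perm.mul_apply, ← Equiv.Perm.iterate_eq_pow,
      hy, hy]
    obtain ⟨M, hM⟩ := hiter (n + 1) i (ν (g n).1 + 2)
    rw [← hyf n i (M + n + i + 1) (by omega), ← hM (M + n + i + 1) (by omega)]
    change P ((l (M + n + i + 1)).drop n) id i = _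
    rw [List.drop_eq_getElem_cons (by rw [hll]; omega)]
    simp only [l, List.getElem_map, List.getElem_range]
    rfl
  have hstep : ∀ n, y (n + 1) ≠ 1 → ν (y (n + 1)) + 1 ≤ ν (y n) := by
    intro n hn
    have h1 := hνp _ hn (ν (g n).1 + 1)
    have h2 : y (n + 1) ^ (ν (g n).1 + 1 + 1) = ((g n).1)⁻¹ * y n := by
      rw [hrec n, inv_mul_cancel_left]
    have h3 := hνm ((g n).1)⁻¹ (y n)
    rw [← h2, hνi] at h3
    omega
  have hne : ∀ n, y n ≠ 1 := by
    intro n hn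
    by_cases h : y (n + 1) = 1
    · have := hrec n
      rw [hn, h, one_pow, mul_one] at this
      exact (g n).2 this.symm
    · have := hstep n h
      rw [hn, hν1] at this
      omega
  have : ∀ n, ν (y n) + n ≤ ν (y 0) := by
    intro n
    induction n with
    | zero => simp
    | succ n ih => have := hstep n (hne _); omega
  have := this (ν (y 0) + 1)
  omega

theorem aux_fresh (G : Subgroup (Equiv.Perm ℕ)) (hG : IsCofinitary G) (ρ : G → ℕ)
    (hρ : Function.Injective ρ) (s : ℕ) (D : Set ℕ) (hD : D.Finite) :
    ∃ φ, φ ∉ D ∧ ∀ γ : G, ρ γ ≤ s →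
      (γ : Equiv.Perm ℕ) φ ∉ D ∧ (γ ≠ 1 → (γ : Equiv.Perm ℕ) φ ≠ φ) := by
  have hF : {γ : G | ρ γ ≤ s}.Finite := (Set.finite_Iic s).preimage hρ.injOn
  have h1 : (D ∪ ⋃ γ ∈ {γ : G | ρ γ ≤ s}, ((γ : Equiv.Perm ℕ) ⁻¹' D ∪
      {n | γ ≠ 1 ∧ (γ : Equiv.Perm ℕ) n = n})).Finite := by
    refine hD.union (hF.biUnion fun γ _ => (hD.preimage (γ : Equiv.Perm ℕ).injective.injOn).union ?_)
    by_cases h : γ = 1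
    · simp [h]
    · refine (hG γ γ.2 (by simpa using h)).subset fun n hn => hn.2
  obtain ⟨φ, hφ⟩ := Set.Infinite.exists_notMem_finite Set.infinite_univ h1
  have hφ := hφ.2
  simp only [Set.mem_union, Set.mem_iUnion, not_or, not_exists] at hφ
  refine ⟨φ, hφ.1, fun γ hγ => ?_⟩
  have := hφ.2 γ hγ
  exact ⟨this.1, fun h1 h2 => this.2 ⟨h1, h2⟩⟩

theorem aux_build (G : Subgroup (Equiv.Perm ℕ)) (hG : IsCofinitary G) (ρ : G → ℕ)
    (hρ : Function.Injective ρ) :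
    ∃ pt : Bool → Equiv.Perm ℕ, (∀ s, pt true s ≠ pt false s) ∧
      ∀ s, ∃ e', ∀ γ : G, ρ γ ≤ s → ∀ t ≤ s, ∀ e, (γ : Equiv.Perm ℕ) (pt e' s) = pt e t →
        γ = 1 ∧ t = s := by
  obtain ⟨f, hf⟩ := aux_seq (fun (l : List (Bool → ℕ)) (y : Bool → ℕ) =>
      (∀ e, ∀ p ∈ l, y e ≠ p e) ∧ y true ≠ y false ∧
      (∀ e, l.length % 2 = (if e then 1 else 0) → (∃ p ∈ l, p e = l.length / 2) ∨ y e = l.length / 2) ∧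
      ∃ e', ∀ γ : G, ρ γ ≤ l.length →
        (∀ p ∈ l, ∀ e, (γ : Equiv.Perm ℕ) (y e') ≠ p e) ∧
        (γ ≠ 1 → ∀ e, (γ : Equiv.Perm ℕ) (y e') ≠ y e)) (by
    intro l
    let D : Set ℕ := {n | ∃ p ∈ l, ∃ e, n = p e}
    have hD : D.Finite := by
      have : D = ⋃ p ∈ {p | p ∈ l}, Set.range p := by
        ext n; simp only [D, Set.mem_ofPred_eq, Set.mem_iUnion, Set.mem_range, exists_prop, eq_comm]
      rw [this]
      exact (List.finite_toSet l).biUnion fun p _ => Set.finite_range p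
    obtain ⟨e0, he0⟩ : ∃ e0 : Bool, l.length % 2 = (if e0 then 1 else 0) := by
      rcases Nat.mod_two_eq_zero_or_one l.length with h | h
      · exact ⟨false, by simp [h]⟩
      · exact ⟨true, by simp [h]⟩
    have he0u : ∀ e : Bool, l.length % 2 = (if e then 1 else 0) → e = e0 := by
      intro e he
      rw [he0] at he
      cases e <;> cases e0 <;> simp at he ⊢
    obtain ⟨n, hn1, hn2⟩ : ∃ n, (∀ p ∈ l, n ≠ p e0) ∧
        ((∃ p ∈ l, p e0 = l.length / 2) ∨ n = l.length / 2) := by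
      by_cases h : ∃ p ∈ l, p e0 = l.length / 2
      · obtain ⟨n, hn⟩ := Set.Infinite.exists_notMem_finite Set.infinite_univ hD
        exact ⟨n, fun p hp h => hn.2 ⟨p, hp, e0, h⟩, Or.inl h⟩
      · exact ⟨_, fun p hp h' => h ⟨p, hp, h'.symm⟩, Or.inr rfl⟩
    obtain ⟨φ, hφ1, hφ2⟩ := aux_fresh G hG ρ hρ l.length (insert n D) (hD.insert n)
    have hφn : φ ≠ n := fun h => hφ1 (by simp [h])
    refine ⟨fun e => if e = e0 then n else φ, ?_, ?_, ?_, !e0, ?_⟩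
    · intro e p hp
      by_cases h : e = e0
      · subst h; simpa using hn1 p hp
      · simp only [h, if_false]
        exact fun h => hφ1 (Or.inr ⟨p, hp, e, h⟩)
    · cases e0 <;> simp [hφn, hφn.symm]
    · intro e he
      obtain rfl := he0u e he
      simpa using hn2
    · intro γ hγ
      have := hφ2 γ hγ
      have h0 : (!e0) ≠ e0 := by cases e0 <;> simp
      simp only [h0, if_false]
      refine ⟨fun p hp e h => this.1 (Or.inr ⟨p, hp, e, h⟩), fun h1 e => ?_⟩
      by_cases h : e = e0
      · simp only [h, if_true]
        exact fun h => this.1 (Or.inl h)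
      · simp only [h, if_false]
        exact this.2 h1)
  simp only [List.length_map, List.length_range, List.mem_map, List.mem_range,
    forall_exists_index, and_imp, forall_apply_eq_imp_iff₂, exists_exists_and_eq_and] at hf
  have hinj : ∀ e, Function.Injective (fun s => f s e) := by
    intro e s t h
    by_contra hne
    rcases lt_or_gt_of_ne hne with h' | h'
    · exact (hf t).1 e s h' h.symm
    · exact (hf s).1 e t h' h
  have hsurj : ∀ e, Function.Surjective (fun s => f s e) := by
    intro e n
    have := (hf (2 * n + (if e then 1 else 0))).2.2.1 e (by cases e <;> simp <;> omega)
    have h2 : (2 * n + (if e then 1 else 0)) / 2 = n := by cases e <;> simp <;> omega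
    rw [h2] at this
    rcases this with ⟨s, _, h⟩ | h
    · exact ⟨s, h⟩
    · exact ⟨_, h⟩
  refine ⟨fun e => Equiv.ofBijective _ ⟨hinj e, hsurj e⟩, fun s => (hf s).2.1, fun s => ?_⟩
  obtain ⟨e', he'⟩ := (hf s).2.2.2
  refine ⟨e', fun γ hγ t ht e h => ?_⟩
  simp only [Equiv.ofBijective_apply] at h
  rcases ht.lt_or_eq with ht | rfl
  · exact absurd h ((he' γ hγ).1 t ht e)
  · refine ⟨?_, rfl⟩
    by_contra h1
    exact (he' γ hγ).2 h1 e h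

def auxHH (pt : Bool → Equiv.Perm ℕ) (e : Bool) : Equiv.Perm ℕ := pt (!e) * (pt e)⁻¹

def auxVal (G : Subgroup (Equiv.Perm ℕ)) (pt : Bool → Equiv.Perm ℕ) (L : List (Bool × G)) :
    Equiv.Perm ℕ := (L.map fun p => auxHH pt p.1 * (p.2 : Equiv.Perm ℕ)).prod

theorem auxVal_append (G : Subgroup (Equiv.Perm ℕ)) (pt : Bool → Equiv.Perm ℕ)
    (L M : List (Bool × G)) : auxVal G pt (L ++ M) = auxVal G pt L * auxVal G pt M := by
  unfold auxVal
  rw [List.map_append, List.prod_append]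

theorem auxVal_single (G : Subgroup (Equiv.Perm ℕ)) (pt : Bool → Equiv.Perm ℕ)
    (p : Bool × G) : auxVal G pt [p] = auxHH pt p.1 * (p.2 : Equiv.Perm ℕ) := by
  simp [auxVal]

def auxFin (x : Equiv.Perm ℕ) : Prop := x = 1 ∨ {n : ℕ | x n = n}.Finite

theorem auxFin_conj (x c : Equiv.Perm ℕ) (h : auxFin (c⁻¹ * x * c)) : auxFin x := by
  rcases h with h | h
  · left
    have : x = c * (c⁻¹ * x * c) * c⁻¹ := by group
    rw [this, h]; group
  · right
    refine (h.image c).subset fun n hn => ⟨c⁻¹ n, ?_, by simp⟩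
    have hn : x n = n := hn
    simp [hn]

set_option maxHeartbeats 1000000 in
/-- the path argument -/
theorem aux_path (G : Subgroup (Equiv.Perm ℕ)) (ρ : G → ℕ)
    (pt : Bool → Equiv.Perm ℕ) (hne : ∀ s, pt true s ≠ pt false s)
    (hfr : ∀ s, ∃ e', ∀ γ : G, ρ γ ≤ s → ∀ t ≤ s, ∀ e, (γ : Equiv.Perm ℕ) (pt e' s) = pt e t →
        γ = 1 ∧ t = s)
    (L : List (Bool × G)) (hL : 0 < L.length) (p : ℕ → Bool × G)
    (hp : ∀ i, p i = L[i % L.length]'(Nat.mod_lt _ hL))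
    (hnc : ∀ j < L.length, ¬ ((p j).2 = 1 ∧ (p (j + 1)).1 = !(p j).1)) :
    {n : ℕ | auxVal G pt L n = n}.Finite := by
  obtain ⟨s0, hs0⟩ : ∃ s0, ∀ i < L.length, ρ (p i).2 ≤ s0 ∧ ρ (p i).2⁻¹ ≤ s0 := by
    refine ⟨∑ i ∈ Finset.range L.length, (ρ (p i).2 + ρ (p i).2⁻¹), fun i hi => ?_⟩
    have := Finset.single_le_sum (f := fun i => ρ (p i).2 + ρ (p i).2⁻¹)
      (s := Finset.range L.length) (fun _ _ => Nat.zero_le _) (Finset.mem_range.2 hi)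
    beta_reduce at this
    omega
  let C : ℕ → Equiv.Perm ℕ := fun i => auxVal G pt (L.take i)
  have hC : ∀ i < L.length, C (i + 1) = C i * (auxHH pt (p i).1 * ((p i).2 : Equiv.Perm ℕ)) := by
    intro i hi
    have : L.take (i + 1) = L.take i ++ [p i] := by
      rw [hp]; simp only [Nat.mod_eq_of_lt hi]; rw [List.take_concat_get' _ _ hi]
    simp only [C, this, auxVal_append, auxVal_single]
  have hsub : {n : ℕ | auxVal G pt L n = n} ⊆ ⋃ i ∈ Set.Iio L.length, ⋃ e : Bool,
      ((C i)⁻¹ : Equiv.Perm ℕ) ⁻¹' ((pt e) '' Set.Iio s0) := by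
    intro x hx
    have hx : auxVal G pt L x = x := hx
    by_contra hcon
    simp only [Set.mem_iUnion, not_exists] at hcon
    let t : ℕ → ℕ := fun i => (pt (!(p i).1))⁻¹ ((C i)⁻¹ x)
    have ht : ∀ i, pt (!(p i).1) (t i) = (C i)⁻¹ x := by intro i; simp [t]
    have hts : ∀ i < L.length, s0 ≤ t i := by
      intro i hi
      by_contra h
      exact hcon i hi (!(p i).1) ⟨t i, by simpa using h, ht i⟩
    have hpn : p L.length = p 0 := by rw [hp, hp]; simp
    have htn : t L.length = t 0 := by
      have h1 : (C L.length)⁻¹ x = x := by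
        rw [Equiv.Perm.inv_eq_iff_eq]; simp [C, hx]
      have h2 : (C 0)⁻¹ x = x := by simp [C, auxVal]
      simp only [t, hpn, h1, h2]
    have hstep : ∀ i < L.length,
        ((p i).2 : Equiv.Perm ℕ) (pt (!(p (i + 1)).1) (t (i + 1))) = pt (p i).1 (t i) := by
      intro i hi
      rw [ht, hC i hi]
      have h1 := ht i
      rw [mul_inv_rev, Equiv.Perm.mul_apply, ← h1, mul_inv_rev, auxHH]
      simp
    obtain ⟨i0, hi0, hmax⟩ := Finset.exists_max_image (Finset.range L.length) t
      ⟨0, Finset.mem_range.2 hL⟩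
    rw [Finset.mem_range] at hi0
    have hmax' : ∀ i ≤ L.length, t i ≤ t i0 := by
      intro i hi
      rcases hi.lt_or_eq with h | rfl
      · exact hmax i (Finset.mem_range.2 h)
      · rw [htn]; exact hmax 0 (Finset.mem_range.2 hL)
    have hpt : ∀ e e' s, pt e s = pt e' s → e = e' := by
      intro e e' s h
      cases e <;> cases e' <;> first | rfl | exact absurd h (hne s) | exact absurd h.symm (hne s)
    obtain ⟨e', he'⟩ := hfr (t i0)
    by_cases hc : e' = (p i0).1
    · have h1 := hstep i0 hi0
      have h2 := he' ((p i0).2)⁻¹ ((hs0 i0 hi0).2.trans (hts i0 hi0)) (t (i0 + 1))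
        (hmax' _ (by omega)) (!(p (i0 + 1)).1) (by rw [hc, ← h1]; simp)
      have h3 : (p i0).2 = 1 := by simpa using h2.1
      rw [h2.2, h3] at h1
      have h4 := hpt _ _ _ h1
      exact hnc i0 hi0 ⟨h3, by rw [← h4]; simp⟩
    · have hc : e' = !(p i0).1 := by
        exact Bool.eq_not_of_ne hc
      obtain ⟨j, hj, hj1, hj2⟩ : ∃ j < L.length, p (j + 1) = p i0 ∧ t (j + 1) = t i0 := by
        rcases Nat.eq_zero_or_pos i0 with h | h
        · refine ⟨L.length - 1, by omega, ?_⟩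
          rw [show L.length - 1 + 1 = L.length by omega, h]
          exact ⟨hpn, htn⟩
        · exact ⟨i0 - 1, by omega, by rw [show i0 - 1 + 1 = i0 by omega]; simp⟩
      have h1 := hstep j hj
      rw [hj1, hj2, ← hc] at h1
      have h2 := he' (p j).2 ((hs0 j hj).1.trans (hts i0 hi0)) (t j) (hmax' j hj.le) _ h1
      rw [h2.1, h2.2] at h1
      have h4 := hpt _ _ _ h1
      exact hnc j hj ⟨h2.1, by rw [hj1, ← h4, hc]; simp⟩
  refine Set.Finite.subset ?_ hsub
  refine (Set.finite_Iio _).biUnion fun i _ => Set.finite_iUnion fun e => ?_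
  exact ((Set.finite_Iio s0).image _).preimage (Equiv.injective _).injOn

theorem aux_gval (G : Subgroup (Equiv.Perm ℕ)) (hG : IsCofinitary G)
    (pt : Bool → Equiv.Perm ℕ) (T : List (Bool × G)) (g : G)
    (h : ∀ L : List (Bool × G), L.length = T.length → auxFin (auxVal G pt L)) :
    auxFin (g * auxVal G pt T) := by
  rcases List.eq_nil_or_concat T with rfl | ⟨T0, ⟨e, g0⟩, rfl⟩
  · by_cases h1 : g = 1
    · left; simp [h1, auxVal]
    · right
      simpa [auxVal] using hG g g.2 (by simpa using h1)
  · apply auxFin_conj _ (g : Equiv.Perm ℕ)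
    have := h (T0 ++ [(e, g0 * g)]) (by simp)
    convert this using 1
    simp [auxVal, mul_assoc]

theorem aux_val_fin (G : Subgroup (Equiv.Perm ℕ)) (hG : IsCofinitary G) (ρ : G → ℕ)
    (pt : Bool → Equiv.Perm ℕ) (hne : ∀ s, pt true s ≠ pt false s)
    (hfr : ∀ s, ∃ e', ∀ γ : G, ρ γ ≤ s → ∀ t ≤ s, ∀ e, (γ : Equiv.Perm ℕ) (pt e' s) = pt e t →
        γ = 1 ∧ t = s) (n : ℕ) :
    ∀ L : List (Bool × G), L.length = n → auxFin (auxVal G pt L) := by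
  induction n using Nat.strong_induction_on with
  | _ n ih =>
  intro L hLn
  rcases Nat.eq_zero_or_pos L.length with hL | hL
  · left
    rw [List.length_eq_zero_iff.1 hL]; simp [auxVal]
  by_cases hnc : ∀ j < L.length, ¬ ((L[j % L.length]'(Nat.mod_lt _ hL)).2 = 1 ∧
      (L[(j + 1) % L.length]'(Nat.mod_lt _ hL)).1 = !(L[j % L.length]'(Nat.mod_lt _ hL)).1)
  · right
    exact aux_path G ρ pt hne hfr L hL (fun i => L[i % L.length]'(Nat.mod_lt _ hL)) (fun _ => rfl) hnc
  · push Not at hnc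
    obtain ⟨j, hj, h1, h2⟩ := hnc
    apply auxFin_conj _ (auxVal G pt (L.take j))
    have hrot : (auxVal G pt (L.take j))⁻¹ * auxVal G pt L * auxVal G pt (L.take j) =
        auxVal G pt (L.rotate j) := by
      rw [List.rotate_eq_drop_append_take hj.le]
      have e : auxVal G pt L = auxVal G pt (L.take j) * auxVal G pt (L.drop j) := by
        rw [← auxVal_append, List.take_append_drop]
      rw [auxVal_append, e]
      group
    rw [hrot]
    have hl : (L.rotate j).length = L.length := List.length_rotate _ _
    have e0 : ∀ h, (L.rotate j)[0]'h = L[j % L.length]'(Nat.mod_lt _ hL) := by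
      intro h; rw [List.getElem_rotate]; simp
    have e1 : ∀ h, (L.rotate j)[1]'h = L[(j + 1) % L.length]'(Nat.mod_lt _ hL) := by
      intro h; rw [List.getElem_rotate]; simp [add_comm]
    rcases hR : L.rotate j with _ | ⟨⟨a, ga⟩, _ | ⟨⟨b, gb⟩, T⟩⟩
    · rw [hR] at hl; simp at hl; omega
    · rw [hR] at hl
      have hl1 : L.length = 1 := by simpa using hl.symm
      exfalso
      simp only [hl1, Nat.mod_one] at h2
      cases h : (L[0]'hL).1 <;> simp [h] at h2
    · simp only [hR] at e0 e1 hl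
      have e0 := e0 (by simp)
      have e1 := e1 (by simp)
      simp only [List.getElem_cons_zero, List.getElem_cons_succ, List.length_cons] at e0 e1 hl
      rw [← e0] at h1 h2
      rw [← e1] at h2
      simp only at h1 h2
      subst h1 h2
      have : auxVal G pt ((a, 1) :: (!a, gb) :: T) = gb * auxVal G pt T := by
        simp [auxVal, auxHH, mul_assoc]
      rw [this]
      exact aux_gval G hG pt T gb (ih T.length (by omega))

theorem aux_adeleke (G : Subgroup (Equiv.Perm ℕ)) (hmax : IsMaximalCofinitary G)
    (hc : Countable G) : False := by
  obtain ⟨hG, hmax⟩ := hmax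
  obtain ⟨ρ, hρ⟩ := hc.exists_injective_nat
  obtain ⟨pt, hne, hfr⟩ := aux_build G hG ρ hρ
  let h := auxHH pt true
  have hh : (auxHH pt true)⁻¹ = auxHH pt false := by simp [auxHH]
  have key : ∀ x ∈ Subgroup.closure ((G : Set (Equiv.Perm ℕ)) ∪ {auxHH pt true}),
      ∃ (g : G) (L : List (Bool × G)), x = g * auxVal G pt L := by
    intro x hx
    induction hx using Subgroup.closure_induction_left with
    | one => exact ⟨1, [], by simp [auxVal]⟩
    | mul_left x hx y hy ih =>
      obtain ⟨g, L, rfl⟩ := ih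
      rcases hx with hx | hx
      · exact ⟨⟨x, hx⟩ * g, L, by simp [mul_assoc]⟩
      · rw [Set.mem_singleton_iff] at hx
        exact ⟨1, (true, g) :: L, by simp [auxVal, hx, mul_assoc]⟩
    | inv_mul_cancel x hx y hy ih =>
      obtain ⟨g, L, rfl⟩ := ih
      rcases hx with hx | hx
      · exact ⟨⟨x, hx⟩⁻¹ * g, L, by simp [mul_assoc]⟩
      · rw [Set.mem_singleton_iff] at hx
        exact ⟨1, (false, g) :: L, by simp [auxVal, hx, hh, mul_assoc]⟩
  have hcof : IsCofinitary (Subgroup.closure ((G : Set (Equiv.Perm ℕ)) ∪ {auxHH pt true})) := by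
    intro x hx hx1
    obtain ⟨g, L, rfl⟩ := key x hx
    exact (aux_gval G hG pt L g (aux_val_fin G hG ρ pt hne hfr _)).resolve_left hx1
  have heq := hmax _ hcof (fun x hx => Subgroup.subset_closure (Or.inl hx))
  have hmem : auxHH pt true ∈ G := by
    rw [heq]; exact Subgroup.subset_closure (Or.inr rfl)
  have hmem' : auxHH pt false ∈ G := by rw [← hh]; exact G.inv_mem hmem
  have hmem2 : ∀ e, auxHH pt e ∈ G := by intro e; cases e <;> assumption
  obtain ⟨e', he'⟩ := hfr (ρ ⟨_, hmem⟩ + ρ ⟨_, hmem'⟩)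
  have := he' ⟨_, hmem2 e'⟩ (by cases e' <;> simp) _ le_rfl (!e') (by simp [auxHH])
  have h1 : auxHH pt e' = 1 := by simpa using congrArg Subtype.val this.1
  have h2 := congrArg (fun σ : Equiv.Perm ℕ => σ (pt e' 0)) h1
  have h3 : (pt e')⁻¹ (pt e' 0) = 0 := by simp
  simp only [auxHH, Equiv.Perm.mul_apply, h3, Equiv.Perm.one_apply] at h2
  cases e'
  · exact hne 0 h2
  · exact hne 0 h2.symm

theorem freely_generated_mcg_not_Gdelta (G : Subgroup (Equiv.Perm ℕ))
    (hmax : IsMaximalCofinitary G)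
    (hfree : ∃ F : Set (Equiv.Perm ℕ), F ⊆ (G : Set (Equiv.Perm ℕ)) ∧
      FreelyGenerates F ∧ Subgroup.closure F = G) :
    ¬ IsGδ ((fun g : Equiv.Perm ℕ => (g : ℕ → ℕ)) '' (G : Set (Equiv.Perm ℕ))) := by
  classical
  obtain ⟨F, -, ⟨φ, -⟩, rfl⟩ := hfree
  intro hGd
  by_cases hnd : ∀ N : ℕ, ∃ g : Subgroup.closure F, g ≠ 1 ∧ ∀ i < N, (g : Equiv.Perm ℕ) i = i
  · refine aux_dudley _ (fun g => (φ.symm g).norm) (by simp) ?_ ?_ ?_ hnd hGd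
    · intro a b
      simpa using FreeGroup.norm_mul_le (φ.symm a) (φ.symm b)
    · intro a; simp
    · intro a ha k
      simpa using aux_norm_pow (φ.symm a) (by simpa using ha) k
  · push Not at hnd
    obtain ⟨N, hN⟩ := hnd
    refine aux_adeleke _ hmax ?_
    refine Function.Injective.countable
      (f := fun (g : Subgroup.closure F) (i : Fin N) => (g : Equiv.Perm ℕ) i) ?_
    intro a b hab
    by_contra hne
    obtain ⟨i, hi, hi2⟩ := hN (a⁻¹ * b) (by rwa [Ne, inv_mul_eq_one])
    apply hi2
    have : (a : Equiv.Perm ℕ) i = (b : Equiv.Perm ℕ) i := congrFun hab ⟨i, hi⟩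
    simp [← this]
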